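/- arXiv:math/0011250 — 3 statements merged into one kernel-verified Lean document; each statement's English description precedes it below -/
import Mathlib

section
/- Let w : ℤ × ℤ → ℝ be nonnegative with w(j,k) = 0 unless j ≥ 1 and k ≥ 1. Define G : ℤ × ℤ → ℝ by G(M,N) = 0 if M ≤ 0 or N ≤ 0, and G(M,N) = max( G(M−1,N), G(M,N−1) ) + w(M,N) otherwise. Define h : ℤ × ℕ → ℝ by h(x,0) = 0 and, for t ≥ 1, h(x,t) = max( h(x−1,t−1), h(x,t−1), h(x+1,t−1) ) + W(x,t), where W(x,t) = w( (t+x+1)/2, (t−x+1)/2 ) if t+x is odd and W(x,t) = 0 if t+x is even. Then for all integers M, N ≥ 1, G(M,N) = h(M−N, M+N−1). -/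
/-- The last-passage recursion `G(M,N) = max(G(M-1,N), G(M,N-1)) + w(M,N)` coincides with
the level-1 height function `h` of the discrete polynuclear growth model driven by the
field `w`: for all `M, N ≥ 1`, `G(M,N) = h(M-N, M+N-1)`. -/
theorem stmt9 (w : ℤ × ℤ → ℝ) (hw : ∀ p, 0 ≤ w p)
    (hw0 : ∀ j k : ℤ, j < 1 ∨ k < 1 → w (j, k) = 0)
    (G : ℤ × ℤ → ℝ)
    (hG0 : ∀ M N : ℤ, M ≤ 0 ∨ N ≤ 0 → G (M, N) = 0)
    (hGrec : ∀ M N : ℤ, 1 ≤ M → 1 ≤ N →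
      G (M, N) = max (G (M - 1, N)) (G (M, N - 1)) + w (M, N))
    (h : ℤ → ℕ → ℝ)
    (hh0 : ∀ x : ℤ, h x 0 = 0)
    (hhrec : ∀ x : ℤ, ∀ t : ℕ,
      h x (t + 1) = max (max (h (x - 1) t) (h x t)) (h (x + 1) t) +
        (if Odd ((t : ℤ) + 1 + x) then
          w ((((t : ℤ) + 1) + x + 1) / 2, (((t : ℤ) + 1) - x + 1) / 2) else 0)) :
    ∀ M N : ℤ, 1 ≤ M → 1 ≤ N → G (M, N) = h (M - N) (M + N - 1).toNat := by
  have rec_all (M N : ℤ) : G (M, N) = max (G (M - 1, N)) (G (M, N - 1)) + w (M, N) := by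
    by_cases hMN : 1 ≤ M ∧ 1 ≤ N
    · exact hGrec M N hMN.1 hMN.2
    · rw [hG0 M N (by omega), hG0 (M - 1) N (by omega), hG0 M (N - 1) (by omega),
        hw0 M N (by omega)]
      simp
  have mono_left (M N : ℤ) : G (M - 1, N) ≤ G (M, N) := by
    rw [rec_all M N]
    exact le_add_of_le_of_nonneg (le_max_left _ _) (hw _)
  have mono_right (M N : ℤ) : G (M, N - 1) ≤ G (M, N) := by
    rw [rec_all M N]
    exact le_add_of_le_of_nonneg (le_max_right _ _) (hw _)
  have height_eq (t : ℕ) : ∀ x : ℤ, h x t = G ((t + x + 1) / 2, (t - x + 1) / 2) := by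
    induction t with
    | zero =>
      intro x
      rw [hh0, hG0 _ _ (by push_cast; omega)]
    | succ t ih =>
      intro x
      rw [hhrec, ih, ih, ih]
      push_cast
      set M : ℤ := ((t : ℤ) + 1 + x + 1) / 2 with hM
      set N : ℤ := ((t : ℤ) + 1 - x + 1) / 2 with hN
      have left_fst : ((t : ℤ) + (x - 1) + 1) / 2 = M - 1 := by omega
      have left_snd : ((t : ℤ) - (x - 1) + 1) / 2 = N := by omega
      have right_fst : ((t : ℤ) + (x + 1) + 1) / 2 = M := by omega
      have right_snd : ((t : ℤ) - (x + 1) + 1) / 2 = N - 1 := by omega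
      rw [left_fst, left_snd, right_fst, right_snd]
      split_ifs with hodd
      · rw [Int.odd_iff] at hodd
        have mid_fst : ((t : ℤ) + x + 1) / 2 = M - 1 := by omega
        have mid_snd : ((t : ℤ) - x + 1) / 2 = N - 1 := by omega
        rw [mid_fst, mid_snd, max_eq_left (mono_right (M - 1) N), ← rec_all]
      · rw [Int.odd_iff] at hodd
        have mid_fst : ((t : ℤ) + x + 1) / 2 = M := by omega
        have mid_snd : ((t : ℤ) - x + 1) / 2 = N := by omega
        rw [mid_fst, mid_snd, max_eq_right (mono_left M N), max_eq_left (mono_right M N),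
          add_zero]
  intro M N hM hN
  rw [height_eq]
  congr 2 <;> omega
end

section
/- For integers x, y define P(x,y) = (1/(4π²)) ∫_{−π}^{π} ∫_{−π}^{π} e^{i(xθ − yφ)} / ( 2i sin θ + 2 sin φ ) dθ dφ (a well-defined Lebesgue integral). Define S : ℤ → ℝ by S(0) = 1/2 and S(u) = sin(πu/2)/(πu) for u ≠ 0. Then for every m ≥ 1 and all distinct integers x_1, …, x_m: Σ_{z ∈ {1,i}^m} ( ∏_{k=1}^{m} z_k ) · det( P( x_j−x_k + Re z_k , −(x_j−x_k) + Im z_k ) )_{j,k=1}^{m} = det( S(x_j − x_k) )_{j,k=1}^{m}. -/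
open Finset

/-- The Kasteleyn coupling function of the Burton–Pemantle measure:
`P(x,y) = (1/4π²) ∫_{-π}^{π} ∫_{-π}^{π} e^{i(xθ - yφ)} / (2i sin θ + 2 sin φ) dθ dφ`. -/
noncomputable def Pcoup (x y : ℤ) : ℂ :=
  (1 / (4 * (Real.pi : ℂ) ^ 2)) *
    ∫ θ in (-Real.pi)..Real.pi, ∫ φ in (-Real.pi)..Real.pi,
      Complex.exp (Complex.I * ((x : ℂ) * (θ : ℂ) - (y : ℂ) * (φ : ℂ))) /
        (2 * Complex.I * (Real.sin θ : ℂ) + 2 * (Real.sin φ : ℂ))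

/-- The discrete sine kernel of density `1/2`: `S(0) = 1/2`, `S(u) = sin(πu/2)/(πu)`. -/
noncomputable def discSine (u : ℤ) : ℝ :=
  if u = 0 then 1 / 2 else Real.sin (Real.pi * u / 2) / (Real.pi * u)

open MeasureTheory in
/-- The Lebesgue measure on one period `(-π, π]`. -/
noncomputable def periodMeasure : Measure ℝ := volume.restrict (Set.Ioc (-Real.pi) Real.pi)

/-- The integrand defining `Pcoup`. -/
noncomputable def couplingIntegrand (x y : ℤ) (θ φ : ℝ) : ℂ :=
  Complex.exp (Complex.I * ((x : ℂ) * (θ : ℂ) - (y : ℂ) * (φ : ℂ))) /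
    (2 * Complex.I * (Real.sin θ : ℂ) + 2 * (Real.sin φ : ℂ))

open MeasureTheory

instance : IsFiniteMeasure periodMeasure := by
  unfold periodMeasure; infer_instance

lemma intervalIntegrable_inv_sqrt_abs_sin (a b : ℝ) :
    IntervalIntegrable (fun x => (√|Real.sin x|)⁻¹) volume a b := by
  have hpi := Real.pi_pos
  have h1 : IntervalIntegrable (fun x => (√|Real.sin x|)⁻¹) volume 0 (Real.pi / 2) := by
    have h := (intervalIntegral.intervalIntegrable_rpow' (a := 0) (b := Real.pi / 2)
      (r := -(1 / 2)) (by norm_num)).const_mul ((√(2 / Real.pi))⁻¹)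
    refine h.mono_fun' (by fun_prop) ?_
    rw [Filter.EventuallyLE, ae_restrict_iff' measurableSet_uIoc]
    refine Filter.Eventually.of_forall fun x hx => ?_
    rw [Set.uIoc_of_le (by positivity)] at hx
    have h2 := Real.mul_le_sin hx.1.le hx.2
    have hx0 := hx.1
    have h3 : 0 < 2 / Real.pi * x := by positivity
    rw [Real.norm_of_nonneg (by positivity), Real.rpow_neg hx.1.le, ← Real.sqrt_eq_rpow,
      ← mul_inv, ← Real.sqrt_mul (by positivity)]
    exact inv_anti₀ (by positivity) (Real.sqrt_le_sqrt (h2.trans (le_abs_self _)))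
  have h2 : IntervalIntegrable (fun x => (√|Real.sin x|)⁻¹) volume (-(Real.pi / 2)) 0 := by
    rw [IntervalIntegrable.iff_comp_neg]
    simpa using h1.symm
  have hper : Function.Periodic (fun x => (√|Real.sin x|)⁻¹) Real.pi := by
    intro x
    simp [Real.sin_add_pi]
  refine hper.intervalIntegrable Real.pi_pos.ne' (t := -(Real.pi / 2)) ?_ a b
  rw [show -(Real.pi / 2) + Real.pi = Real.pi / 2 by ring]
  exact h2.trans h1

lemma integrable_inv_sqrt_abs_sin :
    Integrable (fun x => (√|Real.sin x|)⁻¹) periodMeasure :=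
  (intervalIntegrable_inv_sqrt_abs_sin (-Real.pi) Real.pi).1

lemma ae_sin_ne_zero : ∀ᵐ x ∂periodMeasure, Real.sin x ≠ 0 := by
  refine ae_restrict_of_ae ?_
  have h : (Set.range fun n : ℤ => (n : ℝ) * Real.pi).Countable := Set.countable_range _
  filter_upwards [h.ae_notMem volume] with x hx h0
  obtain ⟨n, hn⟩ := Real.sin_eq_zero_iff.1 h0
  exact hx ⟨n, hn⟩

lemma sqrt_abs_sin_mul_le (θ ψ : ℝ) :
    √|Real.sin θ| * √|Real.sin ψ| ≤
      ‖2 * Complex.I * (Real.sin θ : ℂ) + 2 * (Real.sin (ψ - θ) : ℂ)‖ := by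
  set s := Real.sin θ with hs
  set p := Real.sin (ψ - θ) with hp
  have h1 : |Real.sin ψ| ≤ |s| + |p| := by
    have : Real.sin ψ = s * Real.cos (ψ - θ) + Real.cos θ * p := by
      rw [hs, hp, ← Real.sin_add]; ring_nf
    rw [this]
    refine (abs_add_le _ _).trans ?_
    rw [abs_mul, abs_mul]
    have a1 := Real.abs_cos_le_one (ψ - θ)
    have a2 := Real.abs_cos_le_one θ
    nlinarith [abs_nonneg s, abs_nonneg p]
  have h2 : 2 * Complex.I * (s : ℂ) + 2 * (p : ℂ) = ((2 * p : ℝ) : ℂ) + ((2 * s : ℝ) : ℂ) * Complex.I := by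
    push_cast; ring
  rw [h2, Complex.norm_add_mul_I, ← Real.sqrt_mul (abs_nonneg _)]
  refine Real.sqrt_le_sqrt ?_
  have := mul_le_mul_of_nonneg_left h1 (abs_nonneg s)
  nlinarith [sq_abs s, sq_abs p, sq_nonneg (|s| - |p|), sq_nonneg (|s|), sq_nonneg (|p|)]

lemma integrable_couplingIntegrand_shear (x y : ℤ) :
    Integrable (fun p : ℝ × ℝ => couplingIntegrand x y p.1 (p.2 - p.1))
      (periodMeasure.prod periodMeasure) := by
  refine (integrable_inv_sqrt_abs_sin.mul_prod integrable_inv_sqrt_abs_sin).mono' ?_ ?_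
  · unfold couplingIntegrand
    exact Measurable.aestronglyMeasurable (by fun_prop)
  · filter_upwards [Measure.quasiMeasurePreserving_fst.ae ae_sin_ne_zero,
      Measure.quasiMeasurePreserving_snd.ae ae_sin_ne_zero] with p h1 h2
    unfold couplingIntegrand
    have he : ‖Complex.exp (Complex.I * ((x : ℂ) * (p.1 : ℂ) - (y : ℂ) * ((p.2 - p.1 : ℝ) : ℂ)))‖ = 1 := by
      have := Complex.norm_exp_I_mul_ofReal ((x : ℝ) * p.1 - (y : ℝ) * (p.2 - p.1))
      push_cast at this ⊢
      exact this
    rw [norm_div, he, one_div, ← mul_inv]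
    exact inv_anti₀ (by positivity) (sqrt_abs_sin_mul_le _ _)

lemma couplingIntegrand_periodic (x y : ℤ) (θ : ℝ) :
    Function.Periodic (couplingIntegrand x y θ) (2 * Real.pi) := by
  intro φ
  unfold couplingIntegrand
  rw [Real.sin_add_two_pi]
  congr 1
  rw [Complex.exp_eq_exp_iff_exists_int]
  exact ⟨-y, by push_cast; ring⟩

lemma Pcoup_eq_integral_prod (x y : ℤ) :
    Pcoup x y = (1 / (4 * (Real.pi : ℂ) ^ 2)) *
      ∫ p, couplingIntegrand x y p.1 (p.2 - p.1) ∂(periodMeasure.prod periodMeasure) := by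
  have hpi : -Real.pi ≤ Real.pi := by linarith [Real.pi_pos]
  rw [integral_prod _ (integrable_couplingIntegrand_shear x y)]
  unfold Pcoup
  rw [intervalIntegral.integral_of_le hpi]
  congr 1
  refine integral_congr_ae (Filter.Eventually.of_forall fun θ => ?_)
  change ∫ φ in (-Real.pi)..Real.pi, couplingIntegrand x y θ φ = _
  simp only [periodMeasure]
  rw [← intervalIntegral.integral_of_le hpi,
    intervalIntegral.integral_comp_sub_right (couplingIntegrand x y θ)]
  have := (couplingIntegrand_periodic x y θ).intervalIntegral_add_eq (-Real.pi) (-Real.pi - θ)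
  convert this using 2 <;> ring

lemma couplingIntegrand_combination (u : ℤ) (θ ψ : ℝ) :
    couplingIntegrand (u + 1) (-u) θ (ψ - θ) +
        Complex.I * couplingIntegrand u (-u + 1) θ (ψ - θ) =
      Complex.exp (Complex.I * u * ψ) *
        ((Complex.exp (ψ * Complex.I) + Complex.I) * Complex.exp (θ * Complex.I) ^ 2 /
          ((Complex.exp (ψ * Complex.I) + Complex.I) * Complex.exp (θ * Complex.I) ^ 2 +
            -(Complex.I * Complex.exp (ψ * Complex.I) *
              (Complex.exp (ψ * Complex.I) - Complex.I)))) := by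
  unfold couplingIntegrand
  push_cast
  have e1 : Complex.exp (Complex.I * (((u : ℂ) + 1) * θ - -(u : ℂ) * (ψ - θ))) =
      Complex.exp (Complex.I * u * ψ) * Complex.exp (θ * Complex.I) := by
    rw [← Complex.exp_add]; ring_nf
  have e2 : Complex.exp (Complex.I * ((u : ℂ) * θ - (-(u : ℂ) + 1) * (ψ - θ))) =
      Complex.exp (Complex.I * u * ψ) * (Complex.exp (θ * Complex.I) /
        Complex.exp (ψ * Complex.I)) := by
    rw [← Complex.exp_sub, ← Complex.exp_add]; ring_nf
  have e3 : 2 * Complex.sin θ = (1 / Complex.exp (θ * Complex.I) - Complex.exp (θ * Complex.I)) *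
      Complex.I := by
    rw [Complex.two_sin, neg_mul, Complex.exp_neg, one_div]
  have e4 : 2 * Complex.sin (ψ - θ) = (Complex.exp (θ * Complex.I) / Complex.exp (ψ * Complex.I) -
      Complex.exp (ψ * Complex.I) / Complex.exp (θ * Complex.I)) * Complex.I := by
    rw [Complex.two_sin, ← Complex.exp_sub, ← Complex.exp_sub]; ring_nf
  rw [e1, e2, show 2 * Complex.I * Complex.sin θ = Complex.I * (2 * Complex.sin θ) by ring, e3, e4]
  have hw := Complex.exp_ne_zero (θ * Complex.I)
  have hs := Complex.exp_ne_zero (ψ * Complex.I)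
  set w := Complex.exp (θ * Complex.I)
  set s := Complex.exp (ψ * Complex.I)
  set E := Complex.exp (Complex.I * u * ψ)
  have hI := Complex.I_sq
  have hD : Complex.I * ((1 / w - w) * Complex.I) + (w / s - s / w) * Complex.I =
      ((s + Complex.I) * w ^ 2 + -(Complex.I * s * (s - Complex.I))) / (w * s) := by
    field_simp
    linear_combination (s - s * w ^ 2 - s) * hI
  rw [hD]
  rcases eq_or_ne ((s + Complex.I) * w ^ 2 + -(Complex.I * s * (s - Complex.I))) 0 with h | h
  · simp [h]
  · field_simp

lemma integral_div_of_norm_lt {A B : ℂ} (h : ‖A‖ < ‖B‖) :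
    ∫ θ in (-Real.pi)..Real.pi, A * Complex.exp (θ * Complex.I) ^ 2 /
      (A * Complex.exp (θ * Complex.I) ^ 2 + B) = 0 := by
  have hne : ∀ z ∈ Metric.closedBall (0 : ℂ) 1, A * z ^ 2 + B ≠ 0 := by
    intro z hz h0
    have hz' : ‖z‖ ≤ 1 := by simpa using hz
    have : ‖B‖ = ‖A‖ * ‖z‖ ^ 2 := by
      rw [← norm_pow, ← norm_mul, ← norm_neg]
      congr 1
      linear_combination -h0
    have : ‖z‖ ^ 2 ≤ 1 := pow_le_one₀ (norm_nonneg _) hz'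
    nlinarith [norm_nonneg A]
  have hd : DiffContOnCl ℂ (fun z : ℂ => A * z ^ 2 / (A * z ^ 2 + B)) (Metric.ball 0 |1|) := by
    rw [abs_one]
    apply DifferentiableOn.diffContOnCl
    rw [closure_ball _ one_ne_zero]
    exact DifferentiableOn.div (by fun_prop) (by fun_prop) hne
  have hav := hd.circleAverage
  rw [Real.circleAverage_def] at hav
  simp only [circleMap, zero_add, Complex.ofReal_one, one_mul] at hav
  have hper : Function.Periodic (fun θ : ℝ => A * Complex.exp (θ * Complex.I) ^ 2 /
      (A * Complex.exp (θ * Complex.I) ^ 2 + B)) (2 * Real.pi) := by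
    intro θ
    have : Complex.exp (((θ + 2 * Real.pi : ℝ) : ℂ) * Complex.I) = Complex.exp (θ * Complex.I) := by
      rw [Complex.exp_eq_exp_iff_exists_int]
      exact ⟨1, by push_cast; ring⟩
    simp only [this]
  have hshift := hper.intervalIntegral_add_eq (-Real.pi) 0
  rw [show -Real.pi + 2 * Real.pi = Real.pi by ring, zero_add] at hshift
  rw [hshift]
  have hpi := Real.pi_pos.ne'
  simpa [hpi] using hav

lemma integral_div_of_lt_norm {A B : ℂ} (h : ‖B‖ < ‖A‖) :
    ∫ θ in (-Real.pi)..Real.pi, A * Complex.exp (θ * Complex.I) ^ 2 /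
      (A * Complex.exp (θ * Complex.I) ^ 2 + B) = 2 * Real.pi := by
  have hne : ∀ θ : ℝ, B * Complex.exp (θ * Complex.I) ^ 2 + A ≠ 0 := by
    intro θ h0
    have : ‖A‖ = ‖B‖ := by
      have h1 : A = -(B * Complex.exp (θ * Complex.I) ^ 2) := by linear_combination h0
      rw [h1, norm_neg, norm_mul, norm_pow, Complex.norm_exp_ofReal_mul_I]
      simp
    exact h.ne' this
  have h0 := integral_div_of_norm_lt h
  have hneg := intervalIntegral.integral_comp_neg (a := -Real.pi) (b := Real.pi)
    (fun θ : ℝ => A * Complex.exp (θ * Complex.I) ^ 2 / (A * Complex.exp (θ * Complex.I) ^ 2 + B))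
  rw [neg_neg] at hneg
  rw [← hneg]
  have hcongr : ∀ θ : ℝ, A * Complex.exp (((-θ : ℝ) : ℂ) * Complex.I) ^ 2 /
      (A * Complex.exp (((-θ : ℝ) : ℂ) * Complex.I) ^ 2 + B) =
      1 - B * Complex.exp (θ * Complex.I) ^ 2 / (B * Complex.exp (θ * Complex.I) ^ 2 + A) := by
    intro θ
    have hθ := hne θ
    have hw := Complex.exp_ne_zero (θ * Complex.I)
    rw [Complex.ofReal_neg, neg_mul, Complex.exp_neg]
    set w := Complex.exp (θ * Complex.I)
    have h1 : A * w⁻¹ ^ 2 + B = (B * w ^ 2 + A) / w ^ 2 := by field_simp; ring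
    rw [h1, div_div_eq_mul_div, eq_sub_iff_add_eq, ← add_div, div_eq_one_iff_eq hθ]
    field_simp
    ring
  simp only [hcongr]
  rw [intervalIntegral.integral_sub, h0]
  · simp; ring
  · simp
  · exact (Continuous.div (by fun_prop) (by fun_prop) hne).intervalIntegrable _ _

lemma normSq_exp_add_I_sub (ψ : ℝ) :
    ‖Complex.exp (ψ * Complex.I) + Complex.I‖ ^ 2 -
      ‖Complex.exp (ψ * Complex.I) - Complex.I‖ ^ 2 = 4 * Real.sin ψ := by
  rw [← Complex.normSq_eq_norm_sq, ← Complex.normSq_eq_norm_sq, Complex.normSq_apply,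
    Complex.normSq_apply]
  simp [Complex.exp_ofReal_mul_I_re, Complex.exp_ofReal_mul_I_im]
  ring

lemma integral_couplingIntegrand_combination (u : ℤ) {ψ : ℝ} (hψ : Real.sin ψ ≠ 0)
    (hmem : ψ ∈ Set.Ioc (-Real.pi) Real.pi) :
    ∫ θ, (couplingIntegrand (u + 1) (-u) θ (ψ - θ) +
        Complex.I * couplingIntegrand u (-u + 1) θ (ψ - θ)) ∂periodMeasure =
      (Set.Ioc 0 Real.pi).indicator
        (fun ψ : ℝ => Complex.exp (Complex.I * u * ψ) * (2 * Real.pi)) ψ := by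
  have hpi : -Real.pi ≤ Real.pi := by linarith [Real.pi_pos]
  simp only [couplingIntegrand_combination, periodMeasure]
  rw [← intervalIntegral.integral_of_le hpi, intervalIntegral.integral_const_mul]
  have hB : ‖-(Complex.I * Complex.exp (ψ * Complex.I) *
      (Complex.exp (ψ * Complex.I) - Complex.I))‖ = ‖Complex.exp (ψ * Complex.I) - Complex.I‖ := by
    rw [norm_neg, norm_mul, norm_mul, Complex.norm_I, Complex.norm_exp_ofReal_mul_I]
    simp
  have hsq := normSq_exp_add_I_sub ψ
  rcases lt_or_gt_of_ne hψ with hneg | hpos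
  · have hnot : ψ ∉ Set.Ioc 0 Real.pi := fun hm =>
      absurd (Real.sin_nonneg_of_nonneg_of_le_pi hm.1.le hm.2) (not_le.2 hneg)
    rw [Set.indicator_of_notMem hnot, integral_div_of_norm_lt, mul_zero]
    rw [hB]
    exact lt_of_pow_lt_pow_left₀ 2 (norm_nonneg _) (by linarith)
  · have hin : ψ ∈ Set.Ioc 0 Real.pi := by
      refine ⟨?_, hmem.2⟩
      by_contra hle
      exact absurd (Real.sin_nonpos_of_nonpos_of_neg_pi_le (not_lt.1 hle) hmem.1.le)
        (not_le.2 hpos)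
    rw [Set.indicator_of_mem hin, integral_div_of_lt_norm]
    rw [hB]
    exact lt_of_pow_lt_pow_left₀ 2 (norm_nonneg _) (by linarith)

lemma integral_exp_half_period (u : ℤ) :
    ∫ ψ in (0 : ℝ)..Real.pi, Complex.exp (Complex.I * u * ψ) =
      2 * Real.pi * (Complex.I ^ u * discSine u) := by
  unfold discSine
  split_ifs with h
  · subst h
    simp
    ring
  · have hu : (u : ℂ) ≠ 0 := by exact_mod_cast h
    have hpi : (Real.pi : ℂ) ≠ 0 := by exact_mod_cast Real.pi_ne_zero
    rw [integral_exp_mul_complex (mul_ne_zero Complex.I_ne_zero hu)]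
    push_cast
    have hI : Complex.I ^ u = Complex.exp (Real.pi * u / 2 * Complex.I) := by
      conv_lhs => rw [← Complex.exp_pi_div_two_mul_I, ← Complex.exp_int_mul]
      ring_nf
    have h2 : Complex.exp (Complex.I * u * Real.pi) =
        Complex.exp (Real.pi * u / 2 * Complex.I) * Complex.exp (Real.pi * u / 2 * Complex.I) := by
      rw [← Complex.exp_add]; ring_nf
    have h3 : Complex.sin (Real.pi * u / 2) = ((Complex.exp (Real.pi * u / 2 * Complex.I))⁻¹ -
        Complex.exp (Real.pi * u / 2 * Complex.I)) * Complex.I / 2 := by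
      rw [Complex.sin, ← Complex.exp_neg, neg_mul]
    rw [hI, h2, h3]
    have he := Complex.exp_ne_zero (Real.pi * u / 2 * Complex.I)
    set e := Complex.exp (Real.pi * u / 2 * Complex.I)
    simp only [mul_zero, Complex.exp_zero]
    field_simp
    linear_combination (e ^ 2 - 1) * Complex.I_sq

/-- The combined Kasteleyn kernel is a gauge transform of the discrete sine kernel. -/
lemma Pcoup_combination (u : ℤ) :
    Pcoup (u + 1) (-u) + Complex.I * Pcoup u (-u + 1) = Complex.I ^ u * discSine u := by
  have i1 := integrable_couplingIntegrand_shear (u + 1) (-u)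
  have i2 := (integrable_couplingIntegrand_shear u (-u + 1)).const_mul Complex.I
  have hpi : (Real.pi : ℂ) ≠ 0 := by exact_mod_cast Real.pi_ne_zero
  rw [Pcoup_eq_integral_prod, Pcoup_eq_integral_prod, mul_left_comm, ← mul_add,
    ← integral_const_mul, ← integral_add i1 i2,
    integral_prod_symm (fun p : ℝ × ℝ => couplingIntegrand (u + 1) (-u) p.1 (p.2 - p.1) +
      Complex.I * couplingIntegrand u (-u + 1) p.1 (p.2 - p.1)) (i1.add i2)]
  have hmem : ∀ᵐ ψ ∂periodMeasure, ψ ∈ Set.Ioc (-Real.pi) Real.pi :=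
    ae_restrict_mem measurableSet_Ioc
  have hsub : Set.Ioc 0 Real.pi ∩ Set.Ioc (-Real.pi) Real.pi = Set.Ioc 0 Real.pi :=
    Set.inter_eq_left.2 (Set.Ioc_subset_Ioc_left (by linarith [Real.pi_pos]))
  have hcongr : ∫ ψ, ∫ θ, (couplingIntegrand (u + 1) (-u) θ (ψ - θ) +
        Complex.I * couplingIntegrand u (-u + 1) θ (ψ - θ)) ∂periodMeasure ∂periodMeasure =
      (2 * Real.pi * (Complex.I ^ u * discSine u)) * (2 * Real.pi) := by
    rw [← integral_exp_half_period, ← intervalIntegral.integral_mul_const,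
      intervalIntegral.integral_of_le Real.pi_pos.le, ← hsub,
      ← Measure.restrict_restrict measurableSet_Ioc, ← integral_indicator measurableSet_Ioc]
    refine integral_congr_ae ?_
    filter_upwards [ae_sin_ne_zero, hmem] with ψ h1 h2
    exact integral_couplingIntegrand_combination u h1 h2
  rw [hcongr]
  field_simp
  ring

/-- Multilinearity of the determinant in its columns, summing over a binary choice in each. -/
lemma Matrix.det_of_add_smul {n R : Type*} [Fintype n] [DecidableEq n] [CommRing R]
    (A : Matrix n n R) (B : Matrix n n R) (c : R) :
    Matrix.det (A + c • B) = ∑ z : n → Bool, (∏ k, if z k then 1 else c) *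
      Matrix.det (Matrix.of fun j k => if z k then A j k else B j k) := by
  have h := (Matrix.detRowAlternating (n := n) (R := R)).toMultilinearMap.map_sum
    (α := fun _ => Bool) (fun k b j => (if b then 1 else c) * (if b then A j k else B j k))
  rw [← Matrix.det_transpose]
  convert h using 1
  · change _ = Matrix.det _
    congr 1
    ext k j
    simp
  · refine Finset.sum_congr rfl fun z _ => ?_
    rw [← Matrix.det_mul_row, ← Matrix.det_transpose]
    rfl

/-- The probability of finding particles at positions `x_1, …, x_m` in the zig-zag
particle process of a random domino tiling of the plane (left-hand side, a sum over the
`2^m` choices `z_k ∈ {1, i}`, encoded by booleans) is given by the determinant of the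
discrete sine kernel. -/
theorem stmt17 (m : ℕ) (hm : 1 ≤ m) (x : Fin m → ℤ) (hx : Function.Injective x) :
    (∑ z : Fin m → Bool,
        (∏ k : Fin m, (if z k then (1 : ℂ) else Complex.I)) *
          Matrix.det (Matrix.of fun j k : Fin m =>
            Pcoup (x j - x k + (if z k then 1 else 0))
              (-(x j - x k) + (if z k then 0 else 1))))
      = ((Matrix.det (Matrix.of fun j k : Fin m => discSine (x j - x k)) : ℝ) : ℂ) := by
  have h := Matrix.det_of_add_smul
    (Matrix.of fun j k : Fin m => Pcoup (x j - x k + 1) (-(x j - x k)))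
    (Matrix.of fun j k : Fin m => Pcoup (x j - x k) (-(x j - x k) + 1)) Complex.I
  have hL : (∑ z : Fin m → Bool,
        (∏ k : Fin m, (if z k then (1 : ℂ) else Complex.I)) *
          Matrix.det (Matrix.of fun j k : Fin m =>
            Pcoup (x j - x k + (if z k then 1 else 0))
              (-(x j - x k) + (if z k then 0 else 1)))) =
      Matrix.det ((Matrix.of fun j k : Fin m => Pcoup (x j - x k + 1) (-(x j - x k))) +
        Complex.I • (Matrix.of fun j k : Fin m => Pcoup (x j - x k) (-(x j - x k) + 1))) := by
    rw [h]
    refine Finset.sum_congr rfl fun z _ => ?_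
    congr 2
    ext j k
    by_cases hz : z k <;> simp [hz]
  have hM : (Matrix.of fun j k : Fin m => Pcoup (x j - x k + 1) (-(x j - x k))) +
        Complex.I • (Matrix.of fun j k : Fin m => Pcoup (x j - x k) (-(x j - x k) + 1)) =
      Matrix.of fun j k => Complex.I ^ x j * (Matrix.of fun j k : Fin m =>
        (Complex.I ^ x k)⁻¹ * (Matrix.of fun j k : Fin m => (discSine (x j - x k) : ℂ)) j k) j k := by
    ext j k
    simp only [Matrix.add_apply, Matrix.smul_apply, Matrix.of_apply, smul_eq_mul,
      Pcoup_combination]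
    rw [zpow_sub₀ Complex.I_ne_zero]
    ring
  rw [hL, hM, Matrix.det_mul_column, Matrix.det_mul_row, ← mul_assoc, ← Finset.prod_mul_distrib,
    Finset.prod_eq_one fun k _ => mul_inv_cancel₀ (zpow_ne_zero _ Complex.I_ne_zero), one_mul]
  exact (RingHom.map_det Complex.ofRealHom _).symm
end

section
/- Let u be an integer and θ a real number with θ ∈ (−π, 0) ∪ (0, π). Then (1/(2π)) ∫_{−π}^{π} ( e^{−iφ} − (−1)^u e^{iφ} ) / ( 2i sin(θ−φ) + 2 sin φ ) dφ equals (−1)^u / ( e^{−iθ} + i ) if −π < θ < 0, and equals 1 / ( e^{iθ} + i ) if 0 < θ < π. -/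
open Complex Metric in
/-- The mean value property of the Möbius-type function `(p - q z²) / (a - b z²)`, whose poles lie
outside the closed unit disk. -/
theorem integral_sub_sq_div_sub_sq {a b : ℂ} (hab : ‖b‖ < ‖a‖) (p q : ℂ) :
    (1 / (2 * (Real.pi : ℂ))) * ∫ φ in (-Real.pi)..Real.pi,
      (p - q * exp (I * (φ : ℂ)) ^ 2) / (a - b * exp (I * (φ : ℂ)) ^ 2) = p / a := by
  set f : ℂ → ℂ := fun z ↦ (p - q * z ^ 2) / (a - b * z ^ 2) with hf
  have hne : ∀ z ∈ closedBall (0 : ℂ) 1, a - b * z ^ 2 ≠ 0 := by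
    intro z hz h
    have hz' : ‖z‖ ^ 2 ≤ 1 := pow_le_one₀ (norm_nonneg z) (by simpa using hz)
    have h1 : ‖a‖ = ‖b‖ * ‖z‖ ^ 2 := by rw [sub_eq_zero.mp h, norm_mul, norm_pow]
    nlinarith [norm_nonneg b]
  have hdiff : DiffContOnCl ℂ f (ball 0 |1|) := by
    refine DifferentiableOn.diffContOnCl fun z hz ↦ ?_
    rw [abs_one, closure_ball _ one_ne_zero] at hz
    have hnum : DifferentiableAt ℂ (fun z : ℂ ↦ p - q * z ^ 2) z := by fun_prop
    have hden : DifferentiableAt ℂ (fun z : ℂ ↦ a - b * z ^ 2) z := by fun_prop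
    exact (hnum.div hden (hne z hz)).differentiableWithinAt
  have hmean := hdiff.circleAverage
  have hper : (fun φ : ℝ ↦ f (circleMap 0 1 φ)).Periodic (2 * Real.pi) :=
    fun φ ↦ by simp [periodic_circleMap 0 1 φ]
  have hshift := hper.intervalIntegral_add_eq (-Real.pi) 0
  rw [show -Real.pi + 2 * Real.pi = Real.pi by ring, zero_add] at hshift
  rw [Real.circleAverage_def, ← hshift] at hmean
  simpa [hf, circleMap, mul_comm I, real_smul] using hmean

open Complex in
/-- The denominator of the kernel in terms of `exp (I * φ)`. -/
theorem two_mul_I_mul_sin_sub_add_two_mul_sin (θ φ : ℝ) :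
    2 * I * (Real.sin (θ - φ) : ℂ) + 2 * (Real.sin φ : ℂ) =
      ((exp (I * θ) + I) - (exp (-I * θ) + I) * exp (I * φ) ^ 2) / exp (I * φ) := by
  have h1 : exp (I * (φ : ℂ)) ≠ 0 := exp_ne_zero _
  have h2 : exp (I * (θ : ℂ)) ≠ 0 := exp_ne_zero _
  push_cast
  rw [sin, sin,
    show -((θ : ℂ) - φ) * I = -(I * θ) + I * φ by ring,
    show ((θ : ℂ) - φ) * I = I * θ + -(I * φ) by ring,
    show -(φ : ℂ) * I = -(I * φ) by ring, mul_comm (φ : ℂ) I,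
    neg_mul, exp_add, exp_add, exp_neg, exp_neg]
  field_simp
  linear_combination (exp (I * φ) ^ 2 - exp (I * θ) ^ 2) * I_sq

open Complex in
theorem normSq_exp_I_mul_add_I (θ : ℝ) : normSq (exp (I * θ) + I) = 2 + 2 * Real.sin θ := by
  rw [mul_comm, exp_mul_I, normSq_apply]
  simp [← ofReal_cos, ← ofReal_sin]
  linarith [Real.sin_sq_add_cos_sq θ]

open Complex in
theorem norm_exp_I_mul_add_I_lt {θ η : ℝ} (h : Real.sin θ < Real.sin η) :
    ‖exp (I * θ) + I‖ < ‖exp (I * η) + I‖ := by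
  refine lt_of_pow_lt_pow_left₀ 2 (norm_nonneg _) ?_
  rw [← normSq_eq_norm_sq, ← normSq_eq_norm_sq, normSq_exp_I_mul_add_I, normSq_exp_I_mul_add_I]
  linarith


/-- The residue computation for the zig-zag correlation kernel of the Burton–Pemantle
measure: for `θ ∈ (-π,0) ∪ (0,π)` and `u ∈ ℤ`,
`(1/2π) ∫_{-π}^{π} (e^{-iφ} - (-1)^u e^{iφ}) / (2i sin(θ-φ) + 2 sin φ) dφ`
equals `(-1)^u/(e^{-iθ} + i)` if `θ < 0` and `1/(e^{iθ} + i)` if `θ > 0`. -/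
theorem stmt19 (u : ℤ) (θ : ℝ)
    (hθ : θ ∈ Set.Ioo (-Real.pi) 0 ∪ Set.Ioo 0 Real.pi) :
    (θ ∈ Set.Ioo (-Real.pi) 0 →
      (1 / (2 * (Real.pi : ℂ))) *
          ∫ φ in (-Real.pi)..Real.pi,
            (Complex.exp (-Complex.I * (φ : ℂ)) -
                (-1 : ℂ) ^ u * Complex.exp (Complex.I * (φ : ℂ))) /
              (2 * Complex.I * (Real.sin (θ - φ) : ℂ) + 2 * (Real.sin φ : ℂ))
        = (-1 : ℂ) ^ u / (Complex.exp (-Complex.I * (θ : ℂ)) + Complex.I)) ∧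
    (θ ∈ Set.Ioo 0 Real.pi →
      (1 / (2 * (Real.pi : ℂ))) *
          ∫ φ in (-Real.pi)..Real.pi,
            (Complex.exp (-Complex.I * (φ : ℂ)) -
                (-1 : ℂ) ^ u * Complex.exp (Complex.I * (φ : ℂ))) /
              (2 * Complex.I * (Real.sin (θ - φ) : ℂ) + 2 * (Real.sin φ : ℂ))
        = 1 / (Complex.exp (Complex.I * (θ : ℂ)) + Complex.I)) := by
  have hneg : Complex.exp (-Complex.I * (θ : ℂ)) = Complex.exp (Complex.I * ((-θ : ℝ) : ℂ)) := by
    push_cast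
    ring_nf
  simp only [two_mul_I_mul_sin_sub_add_two_mul_sin]
  refine ⟨fun h ↦ ?_, fun h ↦ ?_⟩
  · have hsin : Real.sin θ < 0 := Real.sin_neg_of_neg_of_neg_pi_lt h.2 h.1
    have hnorm : ‖Complex.exp (Complex.I * (θ : ℂ)) + Complex.I‖ <
        ‖Complex.exp (-Complex.I * (θ : ℂ)) + Complex.I‖ := by
      rw [hneg]
      exact norm_exp_I_mul_add_I_lt (by rw [Real.sin_neg]; linarith)
    rw [← integral_sub_sq_div_sub_sq hnorm ((-1 : ℂ) ^ u) 1]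
    congr 1
    conv_lhs => rw [← neg_neg Real.pi]
    rw [neg_neg (-Real.pi), ← intervalIntegral.integral_comp_neg]
    refine intervalIntegral.integral_congr fun φ _ ↦ ?_
    have hφ : Complex.exp (Complex.I * (φ : ℂ)) ≠ 0 := Complex.exp_ne_zero _
    simp only [Complex.ofReal_neg, neg_mul, mul_neg, neg_neg, Complex.exp_neg (Complex.I * (φ : ℂ))]
    rw [div_div_eq_mul_div,
      ← mul_div_mul_left _ _ (neg_ne_zero.mpr (pow_ne_zero 2 hφ))]
    congr 1 <;> field_simp <;> ring
  · have hsin : 0 < Real.sin θ := Real.sin_pos_of_pos_of_lt_pi h.1 h.2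
    have hnorm : ‖Complex.exp (-Complex.I * (θ : ℂ)) + Complex.I‖ <
        ‖Complex.exp (Complex.I * (θ : ℂ)) + Complex.I‖ := by
      rw [hneg]
      exact norm_exp_I_mul_add_I_lt (by rw [Real.sin_neg]; linarith)
    rw [← integral_sub_sq_div_sub_sq hnorm 1 ((-1 : ℂ) ^ u)]
    congr 1
    refine intervalIntegral.integral_congr fun φ _ ↦ ?_
    have hφ : Complex.exp (Complex.I * (φ : ℂ)) ≠ 0 := Complex.exp_ne_zero _
    simp only [neg_mul, Complex.exp_neg (Complex.I * (φ : ℂ))]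
    rw [div_div_eq_mul_div]
    congr 1
    field_simp
end
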